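/- Define S_m = D_{m+1} − D_m. Then the sequence (S_j)_{j≥0} is the fixed point of the substitution q ↦ B(q) with initial value S_0 = p−2: for every m ≥ 0 and every i with 0 ≤ i ≤ p−1, one has S_{pm+i} = B(S_m)_i, where for q ∈ {0,…,p−2} the block B(q) of length p is given by B(q)_i = p−2−i if i ≤ p−2−q and B(q)_i = p−1−i if i > p−2−q. (This is the statement that S_j equals the substitution-generated sequence Ŝ_j for all j ≥ 0.) -/

import Mathlib

open MeasureTheory
open scoped NNReal ENNReal

namespace Chacon

/-- The space of digit sequences with digits in `{0, …, p-1}`. -/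
def Gamma (p : ℕ) : Set (ℕ → ℕ) := {x | ∀ i, x i < p}

/-- `Γ*`: sequences with digits `< p` having infinitely many coordinates `≠ p - 1`. -/
def GammaStar (p : ℕ) : Set (ℕ → ℕ) :=
  {x | (∀ i, x i < p) ∧ {i | x i ≠ p - 1}.Infinite}

/-- The least index `i` with `x i ≠ p - 1`. -/
noncomputable def firstNot (p : ℕ) (x : ℕ → ℕ) : ℕ :=
  sInf {i | x i ≠ p - 1}

/-- `φ(x) = x_i` where `i` is the least index with `x_i ≠ p - 1`. -/
noncomputable def phi (p : ℕ) (x : ℕ → ℕ) : ℕ :=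
  x (firstNot p x)

/-- The odometer `S` (addition of `1` with carry): the initial run of digits
`p - 1` is replaced by zeros, and the first digit `≠ p - 1` is increased by one. -/
noncomputable def odo (p : ℕ) (x : ℕ → ℕ) : ℕ → ℕ :=
  fun i =>
    if i < firstNot p x then 0
    else if i = firstNot p x then x i + 1
    else x i

/-- `φ^(m)(x) = ∑_{j=0}^{m-1} φ(S^j x)`. -/
noncomputable def phiSum (p m : ℕ) (x : ℕ → ℕ) : ℕ :=
  ∑ j ∈ Finset.range m, phi p ((odo p)^[j] x)

/-- The base-`p` digit sequence of a real number `u`. -/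
noncomputable def digitsOf (p : ℕ) (u : ℝ) : ℕ → ℕ :=
  fun i => (⌊u * (p : ℝ) ^ (i + 1)⌋).toNat % p

/-- `λ`: the product probability measure on digit sequences under which the
coordinates are i.i.d., uniformly distributed in `{0, …, p-1}`; it is realized
concretely as the distribution of the base-`p` digit sequence of a uniformly
distributed random point of `[0,1)`. -/
noncomputable def lam (p : ℕ) : Measure (ℕ → ℕ) :=
  Measure.map (digitsOf p) (volume.restrict (Set.Ico (0 : ℝ) 1))

/-- `π_m(j) = λ({x : φ^(m)(x) = j})`. -/
noncomputable def pim (p m j : ℕ) : ℝ≥0∞ :=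
  lam p {x | phiSum p m x = j}

/-- `P_m^p(t) = ∑_{j ≥ 0} π_m(j) t^j`, a real polynomial
(the sum is over `0 ≤ j ≤ m (p-2)` since `0 ≤ φ^(m) ≤ m (p-2)` a.s.). -/
noncomputable def P (p m : ℕ) (t : ℝ) : ℝ :=
  ∑ j ∈ Finset.range (m * (p - 2) + 1), (pim p m j).toReal * t ^ j

/-- The `n`-th triangular number `Δ_n = n (n+1) / 2`. -/
def tri (n : ℕ) : ℕ := n * (n + 1) / 2

/-- The degree `D_m` of `P_m^p`: the largest `j` with `π_m(j) ≠ 0`. -/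
noncomputable def D (p m : ℕ) : ℕ := sSup {j | pim p m j ≠ 0}

/-- The lower degree `d_m` of `P_m^p`: the least `j` with `π_m(j) ≠ 0`. -/
noncomputable def d (p m : ℕ) : ℕ := sInf {j | pim p m j ≠ 0}


/-- `S_m = D_{m+1} - D_m`. -/
noncomputable def Sseq (p m : ℕ) : ℕ := D p (m + 1) - D p m

/-- The substitution block `B(q)` of length `p`: the descending sequence
`p-2, p-3, …, 1, 0` with the value `q` repeated twice in a row. -/
def blockB (p q i : ℕ) : ℕ := if i ≤ p - 2 - q then p - 2 - i else p - 1 - i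

lemma firstNot_eq {p : ℕ} {x : ℕ → ℕ} {n : ℕ} (hn : x n ≠ p - 1) (h : ∀ i < n, x i = p - 1) :
    firstNot p x = n := by
  refine le_antisymm (Nat.sInf_le hn) ?_
  by_contra! hlt
  exact Nat.sInf_mem (s := {i | x i ≠ p - 1}) ⟨n, hn⟩ (h _ hlt)

lemma eq_of_lt_firstNot {p : ℕ} {x : ℕ → ℕ} {i : ℕ} (h : i < firstNot p x) : x i = p - 1 := by
  by_contra hi
  exact Nat.notMem_of_lt_sInf h hi

lemma apply_firstNot_ne {p : ℕ} {x : ℕ → ℕ} (hx : x ∈ GammaStar p) :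
    x (firstNot p x) ≠ p - 1 :=
  Nat.sInf_mem hx.2.nonempty

lemma phi_le {p : ℕ} {x : ℕ → ℕ} (hx : x ∈ GammaStar p) : phi p x ≤ p - 2 := by
  have h1 := apply_firstNot_ne hx
  have h2 := hx.1 (firstNot p x)
  unfold phi
  omega

lemma odo_mem {p : ℕ} {x : ℕ → ℕ} (hx : x ∈ GammaStar p) : odo p x ∈ GammaStar p := by
  refine ⟨fun i => ?_, ?_⟩
  · have h1 := apply_firstNot_ne hx
    have h2 := hx.1 i
    unfold odo
    split_ifs with h h'
    · omega
    · rw [← h'] at h1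
      omega
    · exact h2
  · refine Set.infinite_of_forall_exists_gt fun n => ?_
    obtain ⟨i, hi, hlt⟩ := hx.2.exists_gt (max n (firstNot p x))
    refine ⟨i, ?_, by omega⟩
    simp only [Set.mem_ofPred_eq, odo]
    rw [if_neg (by omega), if_neg (by omega)]
    exact hi

lemma iterate_odo_mem {p : ℕ} (m : ℕ) {x : ℕ → ℕ} (hx : x ∈ GammaStar p) :
    (odo p)^[m] x ∈ GammaStar p := by
  induction m generalizing x with
  | zero => exact hx
  | succ m ih => exact ih (odo_mem hx)

lemma phiSum_add (p m n : ℕ) (x : ℕ → ℕ) :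
    phiSum p (m + n) x = phiSum p m x + phiSum p n ((odo p)^[m] x) := by
  simp only [phiSum, Finset.sum_range_add, ← Function.iterate_add_apply, add_comm]

lemma phiSum_one (p : ℕ) (x : ℕ → ℕ) : phiSum p 1 x = phi p x := by
  simp [phiSum]

lemma phiSum_le {p : ℕ} (m : ℕ) {x : ℕ → ℕ} (hx : x ∈ GammaStar p) :
    phiSum p m x ≤ m * (p - 2) := by
  simpa [phiSum] using Finset.sum_le_card_nsmul (Finset.range m) (fun j => phi p ((odo p)^[j] x)) (p - 2)
    fun j _ => phi_le (iterate_odo_mem j hx)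

/-- The functional `phiSum p m` depends only on finitely many coordinates near a point of `Γ*`. -/
lemma exists_phiSum_eq_of_agree {p : ℕ} (m : ℕ) {x : ℕ → ℕ} (hx : x ∈ GammaStar p) :
    ∃ N, ∀ y : ℕ → ℕ, (∀ i < N, y i = x i) → phiSum p m y = phiSum p m x := by
  induction m generalizing x with
  | zero => exact ⟨0, fun y _ => by simp [phiSum]⟩
  | succ m ih =>
    obtain ⟨K, hK⟩ := ih (odo_mem hx)
    refine ⟨max K (firstNot p x + 1), fun y hy => ?_⟩
    have hf : firstNot p y = firstNot p x := by
      refine firstNot_eq ?_ fun i hi => ?_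
      · rw [hy _ (by omega)]
        exact apply_firstNot_ne hx
      · rw [hy _ (by omega)]
        exact eq_of_lt_firstNot hi
    have hphi : phi p y = phi p x := by
      unfold phi
      rw [hf, hy _ (by omega)]
    have hodo := hK (odo p y) fun i hi => by
      unfold odo
      rw [hf, hy i (by omega)]
    rw [add_comm, phiSum_add, phiSum_add, phiSum_one, phiSum_one, hphi]
    simpa using hodo

/-! ### The distribution of the digit sequence -/

lemma measurable_digitsOf (p : ℕ) : Measurable (digitsOf p) := by
  refine measurable_pi_lambda _ fun i => ?_
  have h : Measurable fun u : ℝ => ⌊u * (p : ℝ) ^ (i + 1)⌋ :=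
    Int.measurable_floor.comp (measurable_id.mul_const _)
  exact (measurable_from_top (f := fun z : ℤ => z.toNat % p)).comp h

lemma measurableSet_GammaStar (p : ℕ) : MeasurableSet (GammaStar p) := by
  have h : GammaStar p =
      (⋂ i, {x | x i < p}) ∩ ⋂ n, ⋃ i, ⋃ (_ : n < i), {x : ℕ → ℕ | x i ≠ p - 1} := by
    ext x
    simp only [GammaStar, Set.mem_ofPred_eq, Set.mem_inter_iff, Set.mem_iInter, Set.mem_iUnion,
      exists_prop]
    refine and_congr_right fun _ => ⟨fun h n => ?_, fun h => ?_⟩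
    · obtain ⟨i, hi, hlt⟩ := h.exists_gt n
      exact ⟨i, hlt, hi⟩
    · refine Set.infinite_of_forall_exists_gt fun n => ?_
      obtain ⟨i, hlt, hi⟩ := h n
      exact ⟨i, hi, hlt⟩
  rw [h]
  refine (MeasurableSet.iInter fun i => ?_).inter <| MeasurableSet.iInter fun n =>
    MeasurableSet.iUnion fun i => MeasurableSet.iUnion fun _ => ?_
  · exact measurableSet_lt (measurable_pi_apply i) measurable_const
  · exact (measurableSet_eq_fun (measurable_pi_apply i) measurable_const).compl

lemma digitsOf_eq {p : ℕ} (u : ℝ) (i : ℕ) :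
    digitsOf p u i = ⌊u * (p : ℝ) ^ (i + 1)⌋₊ % p := by
  rw [digitsOf, Int.floor_toNat]

lemma floor_mul_pow_succ {p : ℕ} (hp : 0 < p) (u : ℝ) (i : ℕ) :
    ⌊u * (p : ℝ) ^ (i + 1)⌋₊ / p = ⌊u * (p : ℝ) ^ i⌋₊ := by
  rw [← Nat.floor_div_natCast]
  congr 1
  field_simp
  ring

lemma digitsOf_mem {p : ℕ} (hp : 3 ≤ p) {u : ℝ} (hu : 0 ≤ u) : digitsOf p u ∈ GammaStar p := by
  refine ⟨fun i => Nat.mod_lt _ (by omega), Set.infinite_of_forall_exists_gt fun n => ?_⟩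
  by_contra! hcon
  set v : ℕ → ℕ := fun i => ⌊u * (p : ℝ) ^ i⌋₊ with hv
  have hstep : ∀ i, n < i → v (i + 1) + 1 = p * (v i + 1) := fun i hi => by
    have h1 : digitsOf p u i = p - 1 := by
      by_contra h
      exact absurd (hcon i h) (by omega)
    rw [digitsOf_eq] at h1
    have h2 := floor_mul_pow_succ (p := p) (by omega) u i
    have h3 := Nat.div_add_mod (v (i + 1)) p
    simp only [hv] at h3 ⊢
    rw [h1, h2] at h3
    rw [mul_add]
    omega
  have hk : ∀ k, v (n + 1 + k) + 1 = p ^ k * (v (n + 1) + 1) := fun k => by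
    induction k with
    | zero => simp
    | succ k ih => rw [← add_assoc, hstep _ (by omega), ih, pow_succ]; ring
  have hpos : 0 < (v (n + 1) : ℝ) + 1 - u * (p : ℝ) ^ (n + 1) :=
    sub_pos.2 (Nat.lt_floor_add_one _)
  have hp1 : (1 : ℝ) < p := by exact_mod_cast (by omega : 1 < p)
  obtain ⟨k, hlt⟩ := pow_unbounded_of_one_lt
    (1 / ((v (n + 1) : ℝ) + 1 - u * (p : ℝ) ^ (n + 1))) hp1
  rw [div_lt_iff₀ hpos] at hlt
  have hle : (v (n + 1 + k) : ℝ) ≤ u * (p : ℝ) ^ (n + 1 + k) := Nat.floor_le (by positivity)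
  have hk' : (v (n + 1 + k) : ℝ) + 1 = (p : ℝ) ^ k * (v (n + 1) + 1) := by exact_mod_cast hk k
  rw [pow_add] at hle
  nlinarith

/-- The integer with the base-`p` digits `x 0, …, x (n - 1)`, most significant first. -/
def leadingValue (p : ℕ) (x : ℕ → ℕ) : ℕ → ℕ
  | 0 => 0
  | n + 1 => p * leadingValue p x n + x n

lemma digitsOf_eq_of_floor_eq {p : ℕ} {x : ℕ → ℕ} (hx : ∀ i, x i < p) {u : ℝ} {N : ℕ}
    (h : ⌊u * (p : ℝ) ^ N⌋₊ = leadingValue p x N) : ∀ i < N, digitsOf p u i = x i := by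
  have hp : 0 < p := (Nat.zero_le _).trans_lt (hx 0)
  induction N with
  | zero => simp
  | succ N ih =>
    intro i hi
    rcases Nat.lt_succ_iff_lt_or_eq.1 hi with hi | rfl
    · refine ih ?_ i hi
      rw [← floor_mul_pow_succ hp, h, leadingValue, Nat.mul_add_div hp, Nat.div_eq_of_lt (hx N),
        add_zero]
    · rw [digitsOf_eq, h, leadingValue, Nat.mul_add_mod, Nat.mod_eq_of_lt (hx i)]

lemma leadingValue_lt {p : ℕ} {x : ℕ → ℕ} (hx : ∀ i, x i < p) (n : ℕ) :
    leadingValue p x n < p ^ n := by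
  induction n with
  | zero => simp [leadingValue]
  | succ n ih =>
    have := hx n
    rw [leadingValue, pow_succ]
    nlinarith

lemma volume_cylinder_pos {p : ℕ} {x : ℕ → ℕ} (hx : ∀ i, x i < p) (N : ℕ) :
    0 < volume.restrict (Set.Ico (0 : ℝ) 1) {u | ∀ i < N, digitsOf p u i = x i} := by
  have hp : (0 : ℝ) < p := by exact_mod_cast (Nat.zero_le _).trans_lt (hx 0)
  have hpN : (0 : ℝ) < (p : ℝ) ^ N := by positivity
  set V := leadingValue p x N with hV
  have hV1 : (V : ℝ) + 1 ≤ (p : ℝ) ^ N := by exact_mod_cast leadingValue_lt hx N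
  have hsub : Set.Ico ((V : ℝ) / (p : ℝ) ^ N) ((V + 1) / (p : ℝ) ^ N) ⊆
      {u | ∀ i < N, digitsOf p u i = x i} ∩ Set.Ico (0 : ℝ) 1 := by
    rintro u ⟨h1, h2⟩
    have hu : 0 ≤ u := le_trans (by positivity) h1
    rw [div_le_iff₀ hpN] at h1
    refine ⟨digitsOf_eq_of_floor_eq hx ?_, hu, h2.trans_le ((div_le_one hpN).2 hV1)⟩
    rw [lt_div_iff₀ hpN] at h2
    exact (Nat.floor_eq_iff (by positivity)).2 ⟨h1, h2⟩
  rw [Measure.restrict_apply' measurableSet_Ico]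
  refine lt_of_lt_of_le ?_ (measure_mono hsub)
  rw [Real.volume_Ico, ENNReal.ofReal_pos, sub_pos]
  gcongr
  linarith

lemma setOf_pim_ne_zero {p : ℕ} (hp : 3 ≤ p) (m : ℕ) :
    {j | pim p m j ≠ 0} = phiSum p m '' GammaStar p := by
  ext j
  constructor
  · intro hj
    by_contra hcon
    refine hj (measure_mono_null (t := (GammaStar p)ᶜ)
      (fun x hx hx' => hcon ⟨x, hx', hx⟩) ?_)
    rw [lam, Measure.map_apply (measurable_digitsOf p) (measurableSet_GammaStar p).compl,
      Measure.restrict_apply' measurableSet_Ico]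
    convert measure_empty (μ := (volume : Measure ℝ))
    ext u
    simp only [Set.mem_inter_iff, Set.mem_preimage, Set.mem_compl_iff, Set.mem_empty_iff_false,
      iff_false, not_and]
    exact fun h hu => h (digitsOf_mem hp hu.1)
  · rintro ⟨x, hx, rfl⟩
    obtain ⟨N, hN⟩ := exists_phiSum_eq_of_agree m hx
    refine ((volume_cylinder_pos hx.1 N).trans_le ?_).ne'
    exact (measure_mono fun u hu => hN _ hu).trans
      (Measure.le_map_apply (measurable_digitsOf p).aemeasurable _)

lemma zero_mem_GammaStar {p : ℕ} (hp : 3 ≤ p) : (fun _ => 0) ∈ GammaStar p := by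
  refine ⟨fun _ => show 0 < p by omega, ?_⟩
  have h : {i : ℕ | (fun _ : ℕ => 0) i ≠ p - 1} = Set.univ :=
    Set.eq_univ_of_forall fun i => by
      simp only [Set.mem_ofPred_eq]
      omega
  rw [h]
  exact Set.infinite_univ

lemma isGreatest_D {p : ℕ} (hp : 3 ≤ p) (m : ℕ) :
    IsGreatest (phiSum p m '' GammaStar p) (D p m) := by
  have hb : BddAbove (phiSum p m '' GammaStar p) := by
    refine ⟨m * (p - 2), ?_⟩
    rintro _ ⟨x, hx, rfl⟩
    exact phiSum_le m hx
  rw [D, setOf_pim_ne_zero hp]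
  exact ⟨Nat.sSup_mem ⟨_, _, zero_mem_GammaStar hp, rfl⟩ hb, fun j hj => le_csSup hb hj⟩

/-! ### Splitting off the first digit -/

/-- The digit sequence with first digit `a` followed by the sequence `y`. -/
def consDigit (a : ℕ) (y : ℕ → ℕ) : ℕ → ℕ
  | 0 => a
  | n + 1 => y n

lemma consDigit_mem {p a : ℕ} {y : ℕ → ℕ} (ha : a < p) (hy : y ∈ GammaStar p) :
    consDigit a y ∈ GammaStar p := by
  refine ⟨fun i => ?_, Set.infinite_of_forall_exists_gt fun n => ?_⟩
  · cases i with
    | zero => exact ha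
    | succ i => exact hy.1 i
  · obtain ⟨i, hi, hlt⟩ := hy.2.exists_gt n
    exact ⟨i + 1, hi, by omega⟩

lemma exists_eq_consDigit {p : ℕ} {x : ℕ → ℕ} (hx : x ∈ GammaStar p) :
    ∃ a < p, ∃ y ∈ GammaStar p, x = consDigit a y := by
  refine ⟨x 0, hx.1 0, fun n => x (n + 1), ⟨fun i => hx.1 _, ?_⟩, ?_⟩
  · refine Set.infinite_of_forall_exists_gt fun n => ?_
    obtain ⟨i, hi, hlt⟩ := hx.2.exists_gt (n + 1)
    refine ⟨i - 1, ?_, by omega⟩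
    have h : i - 1 + 1 = i := by omega
    simpa only [Set.mem_ofPred_eq, h] using hi
  · ext n
    cases n <;> rfl

lemma firstNot_consDigit_of_ne {p a : ℕ} (ha : a ≠ p - 1) (y : ℕ → ℕ) :
    firstNot p (consDigit a y) = 0 :=
  firstNot_eq ha (by simp)

lemma firstNot_consDigit_last {p : ℕ} {y : ℕ → ℕ} (hy : y ∈ GammaStar p) :
    firstNot p (consDigit (p - 1) y) = firstNot p y + 1 := by
  refine firstNot_eq (apply_firstNot_ne hy) fun i hi => ?_
  cases i with
  | zero => rfl
  | succ i => exact eq_of_lt_firstNot (x := y) (by omega)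

lemma phi_consDigit_of_ne {p a : ℕ} (ha : a ≠ p - 1) (y : ℕ → ℕ) :
    phi p (consDigit a y) = a := by
  rw [phi, firstNot_consDigit_of_ne ha, consDigit]

lemma phi_consDigit_last {p : ℕ} {y : ℕ → ℕ} (hy : y ∈ GammaStar p) :
    phi p (consDigit (p - 1) y) = phi p y := by
  rw [phi, firstNot_consDigit_last hy, consDigit, phi]

lemma odo_consDigit_of_ne {p a : ℕ} (ha : a ≠ p - 1) (y : ℕ → ℕ) :
    odo p (consDigit a y) = consDigit (a + 1) y := by
  ext n
  rw [odo, firstNot_consDigit_of_ne ha]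
  cases n <;> simp [consDigit]

lemma odo_consDigit_last {p : ℕ} {y : ℕ → ℕ} (hy : y ∈ GammaStar p) :
    odo p (consDigit (p - 1) y) = consDigit 0 (odo p y) := by
  ext n
  rw [odo, firstNot_consDigit_last hy]
  cases n <;> simp [consDigit, odo]

/-- The sum of the `i` consecutive integers `a, …, a + i - 1`. -/
def risingSum (a i : ℕ) : ℕ := ∑ k ∈ Finset.range i, (a + k)

/-- The sum of the `i` largest elements of `{0, …, p - 2}`. -/
def topSum (p i : ℕ) : ℕ := ∑ k ∈ Finset.range i, (p - 2 - k)

lemma risingSum_add (a i j : ℕ) : risingSum a (i + j) = risingSum a i + risingSum (a + i) j := by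
  simp only [risingSum, Finset.sum_range_add, add_assoc]

lemma risingSum_le (a i : ℕ) {b : ℕ} (h : a + i ≤ b + 1) :
    risingSum a i ≤ ∑ k ∈ Finset.range i, (b - k) := by
  rw [risingSum, ← Finset.sum_range_reflect]
  refine Finset.sum_le_sum fun k hk => ?_
  rw [Finset.mem_range] at hk
  omega

lemma risingSum_eq_topSum {p a i : ℕ} (h : a + i = p - 1) : risingSum a i = topSum p i := by
  rw [risingSum, topSum, ← Finset.sum_range_reflect]
  refine Finset.sum_congr rfl fun k hk => ?_
  rw [Finset.mem_range] at hk
  omega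

lemma topSum_succ (p i : ℕ) : topSum p (i + 1) = topSum p i + (p - 2 - i) :=
  Finset.sum_range_succ _ _

lemma iterate_odo_consDigit {p : ℕ} {a i : ℕ} (h : a + i ≤ p - 1) (y : ℕ → ℕ) :
    (odo p)^[i] (consDigit a y) = consDigit (a + i) y := by
  induction i with
  | zero => rfl
  | succ i ih =>
    rw [Function.iterate_succ_apply', ih (by omega), odo_consDigit_of_ne (by omega), add_assoc]

lemma phiSum_consDigit {p : ℕ} {a i : ℕ} (h : a + i ≤ p - 1) (y : ℕ → ℕ) :
    phiSum p i (consDigit a y) = risingSum a i := by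
  refine Finset.sum_congr rfl fun k hk => ?_
  rw [Finset.mem_range] at hk
  rw [iterate_odo_consDigit (by omega), phi_consDigit_of_ne (by omega)]

/-- Running from first digit `a` through the digit `p - 1` and up to first digit `s`. -/
lemma iterate_odo_consDigit_carry {p a s : ℕ} (ha : a < p) (hs : s ≤ p - 1) {y : ℕ → ℕ}
    (hy : y ∈ GammaStar p) :
    (odo p)^[(p - 1 - a) + (1 + s)] (consDigit a y) = consDigit s (odo p y) := by
  rw [add_comm, Function.iterate_add_apply, iterate_odo_consDigit (by omega), add_comm 1,
    Function.iterate_add_apply, show a + (p - 1 - a) = p - 1 by omega, Function.iterate_one,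
    odo_consDigit_last hy, iterate_odo_consDigit (by omega), zero_add]

lemma phiSum_consDigit_carry {p a s : ℕ} (ha : a < p) (hs : s ≤ p - 1) {y : ℕ → ℕ}
    (hy : y ∈ GammaStar p) :
    phiSum p ((p - 1 - a) + (1 + s)) (consDigit a y) =
      risingSum a (p - 1 - a) + risingSum 0 s + phi p y := by
  rw [phiSum_add, phiSum_add, phiSum_consDigit (by omega), iterate_odo_consDigit (by omega),
    show a + (p - 1 - a) = p - 1 by omega, phiSum_one, Function.iterate_one,
    odo_consDigit_last hy, phi_consDigit_last hy, phiSum_consDigit (by omega)]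
  ring

lemma iterate_odo_consDigit_mul {p a : ℕ} (ha : a < p) (m : ℕ) {y : ℕ → ℕ}
    (hy : y ∈ GammaStar p) :
    (odo p)^[p * m] (consDigit a y) = consDigit a ((odo p)^[m] y) := by
  induction m with
  | zero => rfl
  | succ m ih =>
    have h := iterate_odo_consDigit_carry ha (by omega : a ≤ p - 1) (iterate_odo_mem m hy)
    rw [show p - 1 - a + (1 + a) = p by omega] at h
    rw [mul_add, mul_one, add_comm, Function.iterate_add_apply, ih, h,
      Function.iterate_succ_apply']

lemma phiSum_consDigit_mul {p a : ℕ} (ha : a < p) (m : ℕ) {y : ℕ → ℕ} (hy : y ∈ GammaStar p) :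
    phiSum p (p * m) (consDigit a y) = m * topSum p (p - 1) + phiSum p m y := by
  induction m with
  | zero => simp [phiSum]
  | succ m ih =>
    have h := phiSum_consDigit_carry ha (by omega : a ≤ p - 1) (iterate_odo_mem m hy)
    have hsum := risingSum_add 0 a (p - 1 - a)
    rw [show a + (p - 1 - a) = p - 1 by omega, risingSum_eq_topSum (zero_add _), zero_add] at hsum
    rw [show p - 1 - a + (1 + a) = p by omega] at h
    rw [mul_add, mul_one, phiSum_add, ih, iterate_odo_consDigit_mul ha m hy, h, phiSum_add,
      phiSum_one, hsum]
    ring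

lemma phiSum_mul_add_of_le {p a i : ℕ} (ha : a < p) (h : a + i ≤ p - 1) (m : ℕ) {y : ℕ → ℕ}
    (hy : y ∈ GammaStar p) :
    phiSum p (p * m + i) (consDigit a y) =
      m * topSum p (p - 1) + phiSum p m y + risingSum a i := by
  rw [phiSum_add, phiSum_consDigit_mul ha m hy, iterate_odo_consDigit_mul ha m hy,
    phiSum_consDigit h]

lemma phiSum_mul_add_carry {p a s : ℕ} (ha : a < p) (hs : s ≤ p - 1) (m : ℕ) {y : ℕ → ℕ}
    (hy : y ∈ GammaStar p) :
    phiSum p (p * m + ((p - 1 - a) + (1 + s))) (consDigit a y) =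
      m * topSum p (p - 1) + phiSum p (m + 1) y + risingSum a (p - 1 - a) + risingSum 0 s := by
  rw [phiSum_add, phiSum_consDigit_mul ha m hy, iterate_odo_consDigit_mul ha m hy,
    phiSum_consDigit_carry ha hs (iterate_odo_mem m hy), phiSum_add p m 1, phiSum_one]
  ring

/-! ### The recursion for the degrees -/

lemma phiSum_le_D {p : ℕ} (hp : 3 ≤ p) (m : ℕ) {x : ℕ → ℕ} (hx : x ∈ GammaStar p) :
    phiSum p m x ≤ D p m :=
  (isGreatest_D hp m).2 ⟨x, hx, rfl⟩

lemma D_zero {p : ℕ} (hp : 3 ≤ p) : D p 0 = 0 := by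
  obtain ⟨x, -, h⟩ := (isGreatest_D hp 0).1
  rw [← h, phiSum, Finset.sum_range_zero]

lemma D_le_succ {p : ℕ} (hp : 3 ≤ p) (m : ℕ) : D p m ≤ D p (m + 1) := by
  obtain ⟨x, hx, h⟩ := (isGreatest_D hp m).1
  have := phiSum_le_D hp (m + 1) hx
  rw [phiSum_add] at this
  omega

lemma D_succ_le {p : ℕ} (hp : 3 ≤ p) (m : ℕ) : D p (m + 1) ≤ D p m + (p - 2) := by
  obtain ⟨x, hx, h⟩ := (isGreatest_D hp (m + 1)).1
  have h1 := phiSum_le_D hp m hx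
  have h2 := phi_le (iterate_odo_mem m hx)
  rw [phiSum_add, phiSum_one] at h
  omega

lemma D_mul {p : ℕ} (hp : 3 ≤ p) (m : ℕ) : D p (p * m) = m * topSum p (p - 1) + D p m := by
  refine le_antisymm ?_ ?_
  · obtain ⟨x, hx, h⟩ := (isGreatest_D hp (p * m)).1
    obtain ⟨a, ha, y, hy, rfl⟩ := exists_eq_consDigit hx
    rw [← h, phiSum_consDigit_mul ha m hy]
    exact Nat.add_le_add_left (phiSum_le_D hp m hy) _
  · obtain ⟨y, hy, h⟩ := (isGreatest_D hp m).1
    rw [← h, ← phiSum_consDigit_mul (by omega : 0 < p) m hy]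
    exact phiSum_le_D hp _ (consDigit_mem (by omega) hy)

lemma D_mul_add_succ {p : ℕ} (hp : 3 ≤ p) (m : ℕ) {i : ℕ} (hi : i + 1 ≤ p - 1) :
    D p (p * m + (i + 1)) =
      m * topSum p (p - 1) + topSum p i + max (D p m + (p - 2 - i)) (D p (m + 1)) := by
  refine le_antisymm ?_ ?_
  · obtain ⟨x, hx, h⟩ := (isGreatest_D hp (p * m + (i + 1))).1
    obtain ⟨a, ha, y, hy, rfl⟩ := exists_eq_consDigit hx
    rw [← h]
    rcases le_or_gt (a + (i + 1)) (p - 1) with hle | hlt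
    · have h1 : risingSum a (i + 1) ≤ topSum p (i + 1) := risingSum_le _ _ (by omega)
      have h2 := phiSum_le_D hp m hy
      rw [topSum_succ] at h1
      rw [phiSum_mul_add_of_le ha hle m hy]
      omega
    · obtain ⟨s, hs⟩ : ∃ s, i + 1 = (p - 1 - a) + (1 + s) := ⟨i - (p - 1 - a), by omega⟩
      have h1 : risingSum a (p - 1 - a) + risingSum 0 s ≤ topSum p i := by
        rw [risingSum_eq_topSum (p := p) (by omega), show i = (p - 1 - a) + s by omega,
          topSum, topSum, Finset.sum_range_add]
        refine Nat.add_le_add_left ((risingSum_le 0 s (b := a - 1) (by omega)).trans ?_) _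
        exact Finset.sum_le_sum fun k _ => by omega
      have h2 := phiSum_le_D hp (m + 1) hy
      rw [hs, phiSum_mul_add_carry ha (by omega) m hy]
      omega
  · rw [← Nat.add_max_add_left]
    refine max_le ?_ ?_
    · obtain ⟨y, hy, h⟩ := (isGreatest_D hp m).1
      have ha : p - 1 - (i + 1) < p := by omega
      have h1 := phiSum_mul_add_of_le ha (by omega : p - 1 - (i + 1) + (i + 1) ≤ p - 1) m hy
      rw [risingSum_eq_topSum (p := p) (by omega), topSum_succ] at h1
      have h2 := phiSum_le_D hp (p * m + (i + 1)) (consDigit_mem ha hy)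
      omega
    · obtain ⟨y, hy, h⟩ := (isGreatest_D hp (m + 1)).1
      have ha : p - 1 - i < p := by omega
      have h1 := phiSum_mul_add_carry ha (Nat.zero_le _) m hy
      rw [risingSum_eq_topSum (p := p) (by omega),
        show p - 1 - (p - 1 - i) = i by omega, show i + (1 + 0) = i + 1 by omega] at h1
      have h2 := phiSum_le_D hp (p * m + (i + 1)) (consDigit_mem ha hy)
      omega

/-- the sequence `S_j = D_{j+1} - D_j` is the fixed point of the
substitution `q ↦ B(q)` with initial value `S_0 = p - 2`: for every `m ≥ 0` and
`0 ≤ i ≤ p-1`, `S_{pm+i} = B(S_m)_i`. -/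
theorem statement_15 (p : ℕ) (hp : 3 ≤ p) :
    Sseq p 0 = p - 2 ∧
    (∀ m i : ℕ, i ≤ p - 1 → Sseq p (p * m + i) = blockB p (Sseq p m) i) := by
  have hrec : ∀ m i : ℕ, i ≤ p - 1 → Sseq p (p * m + i) = blockB p (Sseq p m) i := by
    intro m i hi
    have h1 := D_le_succ hp m
    have h2 := D_succ_le hp m
    have hnext : D p (p * m + (i + 1)) =
        m * topSum p (p - 1) + topSum p i + max (D p m + (p - 2 - i)) (D p (m + 1)) := by
      rcases hi.lt_or_eq with hlt | rfl
      · exact D_mul_add_succ hp m hlt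
      · rw [show p * m + (p - 1 + 1) = p * (m + 1) by rw [mul_add]; omega, D_mul hp, add_mul,
          one_mul]
        omega
    rw [Sseq, Sseq, blockB, add_assoc, hnext]
    cases i with
    | zero =>
      have h0 : topSum p 0 = 0 := rfl
      rw [add_zero, D_mul hp]
      split_ifs <;> omega
    | succ i =>
      rw [D_mul_add_succ hp m hi, topSum_succ]
      split_ifs <;> omega
  refine ⟨?_, hrec⟩
  simpa [blockB] using hrec 0 0 (Nat.zero_le _)

end Chacon
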